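/- (Second variation of the BQC energy.) Let α, β : ℤ → [0,1] be N-periodic and let y ∈ 𝒴 with min_ξ y'_ξ > 0. Then for every u ∈ 𝒰, δ²Φ_{α,β}(y)[u,u] = ε Σ_{ξ=1}^N ( Ā_ξ |u'_ξ|² + ε² B̄_ξ |u''_ξ|² ), where Ā_ξ := φ''(y'_ξ) + 2β_ξ φ''(y'_ξ + y'_{ξ+1}) + 2β_{ξ−1} φ''(y'_{ξ−1} + y'_ξ) + 4α_ξ φ''(2y'_ξ) and B̄_ξ := −β_ξ φ''(y'_ξ + y'_{ξ+1}). -/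

import Mathlib

open scoped BigOperators ENNReal
open Finset

noncomputable section

/-- The lattice spacing `ε = 1/N`. -/
def eps (N : ℕ) : ℝ := (N : ℝ)⁻¹

/-- `u : ℤ → ℝ` is `N`-periodic. -/
def IsPeriodic (N : ℕ) (u : ℤ → ℝ) : Prop := ∀ ξ : ℤ, u (ξ + N) = u ξ

/-- Membership in the space `𝒰` of `N`-periodic mean-zero displacements. -/
def inU (N : ℕ) (u : ℤ → ℝ) : Prop :=
  IsPeriodic N u ∧ ∑ ξ ∈ Finset.Icc (1 : ℤ) (N : ℤ), u ξ = 0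

/-- The uniform deformation `y^F_ξ = F ε ξ`. -/
def yUnif (N : ℕ) (F : ℝ) : ℤ → ℝ := fun ξ => F * eps N * ξ

/-- Membership in the space `𝒴` of admissible deformations. -/
def inY (N : ℕ) (y : ℤ → ℝ) : Prop :=
  ∃ F : ℝ, 0 < F ∧ ∃ u : ℤ → ℝ, inU N u ∧ y = fun ξ => yUnif N F ξ + u ξ

/-- The discrete first derivative `y'_ξ = (y_ξ - y_{ξ-1})/ε`. -/
def d1 (N : ℕ) (y : ℤ → ℝ) (ξ : ℤ) : ℝ := (y ξ - y (ξ - 1)) / eps N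

/-- The discrete second derivative `y''_ξ`. -/
def d2 (N : ℕ) (y : ℤ → ℝ) (ξ : ℤ) : ℝ :=
  (y (ξ + 1) - 2 * y ξ + y (ξ - 1)) / (eps N) ^ 2

/-- The discrete third derivative `y'''_ξ`. -/
def d3 (N : ℕ) (y : ℤ → ℝ) (ξ : ℤ) : ℝ :=
  (y (ξ + 1) - 3 * y ξ + 3 * y (ξ - 1) - y (ξ - 2)) / (eps N) ^ 3

/-- The BQC energy `Φ_{α,β}`. -/
def PhiBQC (N : ℕ) (φ : ℝ → ℝ) (α β : ℤ → ℝ) (y : ℤ → ℝ) : ℝ :=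
  eps N * ∑ ξ ∈ Finset.Icc (1 : ℤ) (N : ℤ),
    (φ (d1 N y ξ) + α ξ * φ (2 * d1 N y ξ) + β ξ * φ (d1 N y ξ + d1 N y (ξ + 1)))

/-- The BQNL energy with blending function `η`. -/
def PhiBQNL (N : ℕ) (φ : ℝ → ℝ) (η : ℤ → ℝ) : (ℤ → ℝ) → ℝ :=
  PhiBQC N φ (fun ξ => 1 - (η ξ + η (ξ - 1)) / 2) η

/-- The BQCE energy with blending function `γ`. -/
def PhiBQCE (N : ℕ) (φ : ℝ → ℝ) (γ : ℤ → ℝ) : (ℤ → ℝ) → ℝ :=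
  PhiBQC N φ (fun ξ => (γ ξ + γ (ξ - 1)) / 2) (fun ξ => 1 - (γ (ξ + 1) + γ (ξ - 1)) / 2)

/-- The atomistic energy `Φ`. -/
def PhiAt (N : ℕ) (φ : ℝ → ℝ) (y : ℤ → ℝ) : ℝ :=
  eps N * ∑ ξ ∈ Finset.Icc (1 : ℤ) (N : ℤ),
    (φ (d1 N y ξ) + φ (d1 N y ξ + d1 N y (ξ + 1)))

/-- The first variation `δΨ(y)[u] = (d/dt)|_{t=0} Ψ(y+tu)`. -/
def fvar (Ψ : (ℤ → ℝ) → ℝ) (y u : ℤ → ℝ) : ℝ :=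
  deriv (fun t : ℝ => Ψ (fun ξ => y ξ + t * u ξ)) 0

/-- The second variation `δ²Ψ(y)[u,u] = (d²/dt²)|_{t=0} Ψ(y+tu)`. -/
def svar (Ψ : (ℤ → ℝ) → ℝ) (y u : ℤ → ℝ) : ℝ :=
  iteratedDeriv 2 (fun t : ℝ => Ψ (fun ξ => y ξ + t * u ξ)) 0

/-- `max_ξ |v_ξ|` (for a periodic sequence this is a genuine maximum). -/
def supAbs (v : ℤ → ℝ) : ℝ := sSup (Set.range fun ξ => |v ξ|)

/-- `min_ξ y'_ξ` (for an admissible deformation this is a genuine minimum). -/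
def infD1 (N : ℕ) (y : ℤ → ℝ) : ℝ := sInf (Set.range fun ξ => d1 N y ξ)

/-- The constant `C_i(r₀) = sup_{r ≥ r₀} |φ^(i)(r)|`. -/
def Cbound (φ : ℝ → ℝ) (i : ℕ) (r₀ : ℝ) : ℝ :=
  sSup ((fun r => |iteratedDeriv i φ r|) '' Set.Ici r₀)

/-- The `ℓ^p_ε` norm over one period, `p ∈ [1,∞]`. -/
def lpnorm (N : ℕ) (p : ℝ≥0∞) (v : ℤ → ℝ) : ℝ :=
  if p = ⊤ then supAbs v
  else (eps N * ∑ ξ ∈ Finset.Icc (1 : ℤ) (N : ℤ), |v ξ| ^ p.toReal) ^ (1 / p.toReal)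

/-- The Hessian coefficient `A_ξ` of the atomistic energy. -/
def Acoef (N : ℕ) (φ : ℝ → ℝ) (y : ℤ → ℝ) (ξ : ℤ) : ℝ :=
  iteratedDeriv 2 φ (d1 N y ξ) + 2 * iteratedDeriv 2 φ (d1 N y ξ + d1 N y (ξ + 1))
    + 2 * iteratedDeriv 2 φ (d1 N y (ξ - 1) + d1 N y ξ)

/-- The Hessian coefficient `Ā_ξ` of the BQC energy. -/
def AbarCoef (N : ℕ) (φ : ℝ → ℝ) (α β : ℤ → ℝ) (y : ℤ → ℝ) (ξ : ℤ) : ℝ :=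
  iteratedDeriv 2 φ (d1 N y ξ) + 2 * β ξ * iteratedDeriv 2 φ (d1 N y ξ + d1 N y (ξ + 1))
    + 2 * β (ξ - 1) * iteratedDeriv 2 φ (d1 N y (ξ - 1) + d1 N y ξ)
    + 4 * α ξ * iteratedDeriv 2 φ (2 * d1 N y ξ)

/-- The coercivity constant `inf { δ²Ψ(y)[u,u] : u ∈ 𝒰, ‖u'‖_{ℓ²_ε} = 1 }`. -/
def coercConst (N : ℕ) (Ψ : (ℤ → ℝ) → ℝ) (y : ℤ → ℝ) : ℝ :=
  sInf { c : ℝ | ∃ u : ℤ → ℝ, inU N u ∧ lpnorm N 2 (d1 N u) = 1 ∧ c = svar Ψ y u }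

end

theorem d1_add_mul (N : ℕ) (y u : ℤ → ℝ) (t : ℝ) (ξ : ℤ) :
    d1 N (fun ζ => y ζ + t * u ζ) ξ = d1 N y ξ + t * d1 N u ξ := by
  simp only [d1]
  ring

theorem IsPeriodic.d1 {N : ℕ} {u : ℤ → ℝ} (hu : IsPeriodic N u) : IsPeriodic N (d1 N u) := by
  intro ξ
  have h : ξ + (N : ℤ) - 1 = ξ - 1 + N := by ring
  simp only [_root_.d1, h, hu ξ, hu (ξ - 1)]

theorem inY.isPeriodic_d1 {N : ℕ} {y : ℤ → ℝ} (hy : inY N y) : IsPeriodic N (d1 N y) := by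
  obtain ⟨F, -, v, hv, rfl⟩ := hy
  intro ξ
  have h := hv.1.d1 ξ
  simp only [d1, yUnif] at h ⊢
  push_cast
  linear_combination h

/-- A positive infimum is not the junk value, so it bounds every difference quotient below. -/
theorem d1_pos_of_infD1_pos {N : ℕ} {y : ℤ → ℝ} (hy : 0 < infD1 N y) (ξ : ℤ) :
    0 < d1 N y ξ := by
  have hbdd : BddBelow (Set.range fun ζ => d1 N y ζ) := by
    by_contra h
    rw [infD1, Real.sInf_of_not_bddBelow h] at hy
    exact lt_irrefl _ hy
  exact hy.trans_le (csInf_le hbdd ⟨ξ, rfl⟩)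

/-- The sum of a sequence over a period does not change under a shift. -/
theorem IsPeriodic.sum_shift {N : ℕ} {g : ℤ → ℝ} (hg : IsPeriodic N g) :
    ∑ ξ ∈ Finset.Icc (1 : ℤ) N, g (ξ - 1) = ∑ ξ ∈ Finset.Icc (1 : ℤ) N, g ξ := by
  have telescope : ∀ n : ℕ,
      ∑ ξ ∈ Finset.Icc (1 : ℤ) n, (g ξ - g (ξ - 1)) = g n - g 0 := by
    intro n
    induction n with
    | zero => simp
    | succ n ih =>
      have h : Finset.Icc (1 : ℤ) ((n + 1 : ℕ) : ℤ) =
          insert ((n : ℤ) + 1) (Finset.Icc (1 : ℤ) n) := by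
        ext x
        simp only [Finset.mem_Icc, Finset.mem_insert]
        omega
      rw [h, Finset.sum_insert (by simp), ih]
      push_cast
      rw [add_sub_cancel_right]
      ring
  have h := telescope N
  have h0 := hg 0
  rw [zero_add] at h0
  rw [Finset.sum_sub_distrib, h0, sub_self] at h
  linarith

theorem contDiffAt_comp_line {φ : ℝ → ℝ} {a : ℝ} (hφ : ContDiffAt ℝ 2 φ a) (b : ℝ) :
    ContDiffAt ℝ 2 (fun t : ℝ => φ (a + t * b)) 0 := by
  have hline : ContDiffAt ℝ 2 (fun t : ℝ => a + t * b) 0 := by fun_prop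
  exact ContDiffAt.comp (g := φ) 0 (by simpa using hφ) hline

theorem iteratedDeriv_two_comp_line {φ : ℝ → ℝ} {a : ℝ} (hφ : ContDiffAt ℝ 2 φ a) (b : ℝ) :
    iteratedDeriv 2 (fun t : ℝ => φ (a + t * b)) 0 = iteratedDeriv 2 φ a * b ^ 2 := by
  have hline : ContDiffAt ℝ 2 (fun t : ℝ => a + t * b) 0 := by fun_prop
  have hderiv : deriv (fun t : ℝ => a + t * b) = fun _ => b := by
    funext t
    simp
  have h := iteratedDeriv_comp_two (g := φ) (f := fun t : ℝ => a + t * b) (x := 0)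
    (by simpa using hφ) hline
  have hzero : iteratedDeriv 2 (fun t : ℝ => a + t * b) 0 = 0 := by
    rw [iteratedDeriv_succ, iteratedDeriv_one, hderiv, deriv_const]
  rw [hzero, hderiv] at h
  simpa [Function.comp_def] using h

/-- The second variation in terms of the strains, before summation by parts. -/
theorem svar_PhiBQC {N : ℕ} {φ : ℝ → ℝ} (hφ : ContDiffOn ℝ 2 φ (Set.Ioi 0)) (α β : ℤ → ℝ)
    {y : ℤ → ℝ} (hy : ∀ ξ, 0 < d1 N y ξ) (u : ℤ → ℝ) :
    svar (PhiBQC N φ α β) y u =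
      eps N * ∑ ξ ∈ Finset.Icc (1 : ℤ) (N : ℤ),
        (iteratedDeriv 2 φ (d1 N y ξ) * d1 N u ξ ^ 2
          + α ξ * (iteratedDeriv 2 φ (2 * d1 N y ξ) * (2 * d1 N u ξ) ^ 2)
          + β ξ * (iteratedDeriv 2 φ (d1 N y ξ + d1 N y (ξ + 1))
              * (d1 N u ξ + d1 N u (ξ + 1)) ^ 2)) := by
  have hφat : ∀ r : ℝ, 0 < r → ContDiffAt ℝ 2 φ r := fun r hr =>
    hφ.contDiffAt (Ioi_mem_nhds hr)
  have hnear : ∀ ξ, ContDiffAt ℝ 2 φ (d1 N y ξ) := fun ξ => hφat _ (hy ξ)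
  have hdouble : ∀ ξ, ContDiffAt ℝ 2 φ (2 * d1 N y ξ) := fun ξ =>
    hφat _ (mul_pos two_pos (hy ξ))
  have hnext : ∀ ξ, ContDiffAt ℝ 2 φ (d1 N y ξ + d1 N y (ξ + 1)) := fun ξ =>
    hφat _ (add_pos (hy ξ) (hy (ξ + 1)))
  have henergy : (fun t : ℝ => PhiBQC N φ α β (fun ξ => y ξ + t * u ξ)) = fun t : ℝ =>
      eps N * ∑ ξ ∈ Finset.Icc (1 : ℤ) (N : ℤ),
        (φ (d1 N y ξ + t * d1 N u ξ) + α ξ * φ (2 * d1 N y ξ + t * (2 * d1 N u ξ))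
          + β ξ * φ (d1 N y ξ + d1 N y (ξ + 1) + t * (d1 N u ξ + d1 N u (ξ + 1)))) := by
    funext t
    simp only [PhiBQC, d1_add_mul]
    congr 1
    refine Finset.sum_congr rfl fun ξ _ => ?_
    congr 3 <;> [congr 1; skip] <;> ring
  have hαterm : ∀ ξ, ContDiffAt ℝ 2
      (fun t : ℝ => α ξ * φ (2 * d1 N y ξ + t * (2 * d1 N u ξ))) 0 := fun ξ =>
    contDiffAt_const.mul (contDiffAt_comp_line (hdouble ξ) _)
  have hβterm : ∀ ξ, ContDiffAt ℝ 2
      (fun t : ℝ => β ξ * φ (d1 N y ξ + d1 N y (ξ + 1) + t * (d1 N u ξ + d1 N u (ξ + 1)))) 0 :=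
    fun ξ => contDiffAt_const.mul (contDiffAt_comp_line (hnext ξ) _)
  have hfirst : ∀ ξ, ContDiffAt ℝ 2 (fun t : ℝ => φ (d1 N y ξ + t * d1 N u ξ)) 0 := fun ξ =>
    contDiffAt_comp_line (hnear ξ) _
  rw [svar, henergy, iteratedDeriv_const_mul_field,
    iteratedDeriv_fun_sum fun ξ _ => ((hfirst ξ).add (hαterm ξ)).add (hβterm ξ)]
  congr 1
  refine Finset.sum_congr rfl fun ξ _ => ?_
  rw [iteratedDeriv_fun_add ((hfirst ξ).add (hαterm ξ)) (hβterm ξ),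
    iteratedDeriv_fun_add (hfirst ξ) (hαterm ξ), iteratedDeriv_const_mul_field,
    iteratedDeriv_const_mul_field, iteratedDeriv_two_comp_line (hnear ξ),
    iteratedDeriv_two_comp_line (hdouble ξ), iteratedDeriv_two_comp_line (hnext ξ)]

theorem eps_mul_d2 {N : ℕ} (hN : N ≠ 0) (u : ℤ → ℝ) (ξ : ℤ) :
    eps N * d2 N u ξ = d1 N u (ξ + 1) - d1 N u ξ := by
  have hε : eps N ≠ 0 := inv_ne_zero (Nat.cast_ne_zero.mpr hN)
  simp only [d1, d2, add_sub_cancel_right]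
  field_simp
  ring

/-- Second variation of the BQC energy. -/
theorem bqc_second_variation
    (N : ℕ) (hN : 5 ≤ N) (φ : ℝ → ℝ) (hφ : ContDiffOn ℝ 4 φ (Set.Ioi 0))
    (α β : ℤ → ℝ) (hαper : IsPeriodic N α) (hβper : IsPeriodic N β)
    (hα01 : ∀ ξ, α ξ ∈ Set.Icc (0 : ℝ) 1) (hβ01 : ∀ ξ, β ξ ∈ Set.Icc (0 : ℝ) 1)
    (y : ℤ → ℝ) (hy : inY N y) (hy' : 0 < infD1 N y)
    (u : ℤ → ℝ) (hu : inU N u) :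
    svar (PhiBQC N φ α β) y u =
      eps N * ∑ ξ ∈ Finset.Icc (1 : ℤ) (N : ℤ),
        (AbarCoef N φ α β y ξ * |d1 N u ξ| ^ 2
          + (eps N) ^ 2 * (-(β ξ) * iteratedDeriv 2 φ (d1 N y ξ + d1 N y (ξ + 1)))
              * |d2 N u ξ| ^ 2) := by
  have hdy := hy.isPeriodic_d1
  have hdu := hu.1.d1
  rw [svar_PhiBQC (hφ.of_le (by norm_num)) α β (d1_pos_of_infD1_pos hy') u]
  congr 1
  have hshift := IsPeriodic.sum_shift (N := N) (g := fun ξ =>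
      2 * β ξ * iteratedDeriv 2 φ (d1 N y ξ + d1 N y (ξ + 1)) * d1 N u (ξ + 1) ^ 2) (by
    intro ξ
    have h : ξ + (N : ℤ) + 1 = ξ + 1 + N := by ring
    simp only [h, hβper ξ, hdy ξ, hdy (ξ + 1), hdu (ξ + 1)])
  simp only [sub_add_cancel] at hshift
  rw [← sub_eq_zero, ← Finset.sum_sub_distrib]
  rw [← sub_eq_zero, ← Finset.sum_sub_distrib, ← neg_eq_zero, ← Finset.sum_neg_distrib] at hshift
  rw [← hshift]
  refine Finset.sum_congr rfl fun ξ _ => ?_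
  have hd2 : eps N ^ 2 * d2 N u ξ ^ 2 = (d1 N u (ξ + 1) - d1 N u ξ) ^ 2 := by
    rw [← mul_pow, eps_mul_d2 (by omega)]
  simp only [AbarCoef, sq_abs]
  linear_combination
    β ξ * iteratedDeriv 2 φ (d1 N y ξ + d1 N y (ξ + 1)) * hd2
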